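/- Let l₀,…,l₄ be ℂ-linearly independent linear forms in R and let M be the 6×6 skew-symmetric matrix over R with rows (0, 0, 0, 0, l₀, l₁), (0, 0, 0, −l₀, 0, l₂), (0, 0, 0, −l₁, −l₂, 0), (0, l₀, l₁, 0, l₃, 0), (−l₀, 0, l₂, −l₃, 0, 0), (−l₁, −l₂, 0, 0, 0, 0) (type (e)). Then Pf(M) = 0; for every 6×6 skew-symmetric matrix M′ all of whose entries are linear forms there is a unique cubic Φ(M′) ∈ R such that Pf(M + εM′) = ε·Φ(M′) in R[ε]/(ε²); the assignment M′ ↦ Φ(M′) is ℂ-linear from the ℂ-vector space of 6×6 skew-symmetric matrices of linear forms to the ℂ-vector space of cubics; and the ℂ-dimension of the range of Φ equals 26. -/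

import Mathlib

open MvPolynomial Matrix

noncomputable section

/-- The polynomial ring `R = ℂ[x₀,…,x₄]`. -/
abbrev Rp : Type := MvPolynomial (Fin 5) ℂ

/-- The sub-Pfaffian `q_{αβ}(N)` of a `6 × 6` matrix: for `α < β` it is
`N_{ij}N_{kl} − N_{ik}N_{jl} + N_{il}N_{jk}` where `i < j < k < l` are the elements of
`{0,…,5} ∖ {α,β}`. -/
def subPf {A : Type*} [CommRing A] (N : Matrix (Fin 6) (Fin 6) A) (α β : Fin 6) : A :=
  match (List.finRange 6).filter (fun i => decide (i ≠ α) && decide (i ≠ β)) with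
  | [i, j, k, m] => N i j * N k m - N i k * N j m + N i m * N j k
  | _ => 0

/-- The Pfaffian of a `6 × 6` skew-symmetric matrix. -/
def pf {A : Type*} [CommRing A] (N : Matrix (Fin 6) (Fin 6) A) : A :=
  N 0 1 * subPf N 0 1 - N 0 2 * subPf N 0 2 + N 0 3 * subPf N 0 3
    - N 0 4 * subPf N 0 4 + N 0 5 * subPf N 0 5

/-- The matrix `M + ε M'` over `R[ε]/(ε²)`, realised via dual numbers. -/
def jet1 (M M' : Matrix (Fin 6) (Fin 6) Rp) : Matrix (Fin 6) (Fin 6) (DualNumber Rp) :=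
  Matrix.of fun i j =>
    TrivSqZeroExt.inl (M i j) + DualNumber.eps * TrivSqZeroExt.inl (M' i j)

/-- The `ℂ`-vector space of `6 × 6` skew-symmetric matrices all of whose entries are
linear forms. -/
def SkewLin : Submodule ℂ (Matrix (Fin 6) (Fin 6) Rp) where
  carrier := {N | Nᵀ = -N ∧ ∀ i j, (N i j).IsHomogeneous 1}
  add_mem' := by
    rintro a b ⟨ha1, ha2⟩ ⟨hb1, hb2⟩
    exact ⟨by rw [Matrix.transpose_add, ha1, hb1, neg_add],
      fun i j => (ha2 i j).add (hb2 i j)⟩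
  zero_mem' := ⟨by simp, fun i j => by
    simpa using MvPolynomial.isHomogeneous_zero (Fin 5) ℂ 1⟩
  smul_mem' := by
    rintro c a ⟨ha1, ha2⟩
    refine ⟨by rw [Matrix.transpose_smul, ha1, smul_neg], fun i j => ?_⟩
    have h : (c • a) i j = MvPolynomial.C c * a i j := by
      simp [Matrix.smul_apply, MvPolynomial.smul_eq_C_mul]
    rw [h]
    exact (ha2 i j).C_mul c

/-- The `ℂ`-vector space of cubic forms in `R`. -/
abbrev Cubics : Submodule ℂ Rp := homogeneousSubmodule (Fin 5) ℂ 3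

/-- The eight quadratic monomials spanning the sub-Pfaffians of the type (e) matrix. -/
def quadIdx : Fin 8 → Fin 5 × Fin 5 :=
  ![(2, 3), (2, 2), (1, 2), (0, 2), (1, 3), (1, 1), (0, 1), (0, 0)]

/-- The exponents (as multisets) of the cubic monomials in the range. -/
def cubExp (p : Fin 8 × Fin 5) : Multiset (Fin 5) :=
  {(quadIdx p.1).1, (quadIdx p.1).2, p.2}

/-- The set of exponents in the range. -/
def cubSet : Finset (Multiset (Fin 5)) := Finset.univ.image cubExp

lemma cubSet_card : cubSet.card = 26 := by decide +kernel

lemma subPf_expand {A : Type*} [CommRing A] (N : Matrix (Fin 6) (Fin 6) A) :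
    pf N = N 0 1 * (N 2 3 * N 4 5 - N 2 4 * N 3 5 + N 2 5 * N 3 4)
      - N 0 2 * (N 1 3 * N 4 5 - N 1 4 * N 3 5 + N 1 5 * N 3 4)
      + N 0 3 * (N 1 2 * N 4 5 - N 1 4 * N 2 5 + N 1 5 * N 2 4)
      - N 0 4 * (N 1 2 * N 3 5 - N 1 3 * N 2 5 + N 1 5 * N 2 3)
      + N 0 5 * (N 1 2 * N 3 4 - N 1 3 * N 2 4 + N 1 4 * N 2 3) := rfl

/-- The matrix of type (e). -/
def matE (l : Fin 5 → Rp) : Matrix (Fin 6) (Fin 6) Rp :=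
  !![0, 0, 0, 0, l 0, l 1;
     0, 0, 0, -l 0, 0, l 2;
     0, 0, 0, -l 1, -l 2, 0;
     0, l 0, l 1, 0, l 3, 0;
     -l 0, 0, l 2, -l 3, 0, 0;
     -l 1, -l 2, 0, 0, 0, 0]

/-- The derivative of the Pfaffian, explicitly. -/
def dPf (l : Fin 5 → Rp) (N : Matrix (Fin 6) (Fin 6) Rp) : Rp :=
  -(l 2 * l 3 * N 0 2) - l 2 * l 2 * N 0 3 + l 1 * l 2 * (N 0 4 + N 1 3)
    - l 0 * l 2 * (N 0 5 + N 2 3) + l 1 * l 3 * N 1 2 - l 1 * l 1 * N 1 4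
    + l 0 * l 1 * (N 1 5 + N 2 4) - l 0 * l 0 * N 2 5

lemma pf_matE (l : Fin 5 → Rp) : pf (matE l) = 0 := by
  rw [subPf_expand]
  simp [matE]
  try ring

lemma pf_jet_matE (l : Fin 5 → Rp) (N : Matrix (Fin 6) (Fin 6) Rp) :
    pf (jet1 (matE l) N) = DualNumber.eps * TrivSqZeroExt.inl (dPf l N) := by
  rw [subPf_expand]
  apply TrivSqZeroExt.ext
  · simp [matE, jet1]
    try ring
  · simp [matE, jet1, dPf]
    try ring

lemma eps_inl_inj {F G : Rp}
    (h : (DualNumber.eps * TrivSqZeroExt.inl F : DualNumber Rp)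
      = DualNumber.eps * TrivSqZeroExt.inl G) : F = G := by
  have := congrArg TrivSqZeroExt.snd h
  simpa using this

lemma dPf_homog (l : Fin 5 → Rp) (hl : ∀ i, (l i).IsHomogeneous 1)
    (N : Matrix (Fin 6) (Fin 6) Rp) (hN : N ∈ SkewLin) : (dPf l N).IsHomogeneous 3 := by
  have h : ∀ i j, N i j ∈ homogeneousSubmodule (Fin 5) ℂ 1 := fun i j => hN.2 i j
  have key : ∀ i j (p : Rp), p ∈ homogeneousSubmodule (Fin 5) ℂ 1 →
      l i * l j * p ∈ homogeneousSubmodule (Fin 5) ℂ 3 := fun i j p hp =>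
    ((hl i).mul (hl j)).mul hp
  have h2 : ∀ i j a b, N i j + N a b ∈ homogeneousSubmodule (Fin 5) ℂ 1 :=
    fun i j a b => add_mem (h i j) (h a b)
  change dPf l N ∈ homogeneousSubmodule (Fin 5) ℂ 3
  unfold dPf
  exact sub_mem (add_mem (sub_mem (add_mem (sub_mem (add_mem (sub_mem (neg_mem
    (key _ _ _ (h _ _))) (key _ _ _ (h _ _))) (key _ _ _ (h2 _ _ _ _)))
    (key _ _ _ (h2 _ _ _ _))) (key _ _ _ (h _ _))) (key _ _ _ (h _ _)))
    (key _ _ _ (h2 _ _ _ _))) (key _ _ _ (h _ _))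

/-- The linear map `Φ`. -/
def PhiE (l : Fin 5 → Rp) (hl : ∀ i, (l i).IsHomogeneous 1) : SkewLin →ₗ[ℂ] Cubics where
  toFun N := ⟨dPf l N.1, dPf_homog l hl N.1 N.2⟩
  map_add' N N' := by
    apply Subtype.ext
    simp [dPf]
    ring
  map_smul' c N := by
    apply Subtype.ext
    simp only [dPf, SetLike.val_smul, Matrix.smul_apply, MvPolynomial.smul_eq_C_mul,
      RingHom.id_apply]
    ring

lemma span_l (l : Fin 5 → Rp) (hl : ∀ i, (l i).IsHomogeneous 1)
    (hind : LinearIndependent ℂ l) :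
    Submodule.span ℂ (Set.range l) = homogeneousSubmodule (Fin 5) ℂ 1 := by
  have e := homogeneousSubmodule_one_eq_span_X (σ := Fin 5) (R := ℂ)
  have : FiniteDimensional ℂ (homogeneousSubmodule (Fin 5) ℂ 1) := by
    rw [e]; exact FiniteDimensional.span_of_finite ℂ (Set.finite_range _)
  apply Submodule.eq_of_le_of_finrank_le
  · rw [Submodule.span_le]
    rintro _ ⟨i, rfl⟩
    exact hl i
  · rw [finrank_span_eq_card hind, e]
    exact finrank_range_le_card _

lemma inj_of_surj_endo (f : Rp →+* Rp) (hs : Function.Surjective f) :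
    Function.Injective f := by
  have hsucc : ∀ (n : ℕ) (x : Rp), (f ^ (n + 1)) x = f ((f ^ n) x) := by
    intro n x
    rw [pow_succ']; rfl
  have hn : ∀ n : ℕ, Function.Surjective ⇑(f ^ n) := by
    intro n
    rw [RingHom.coe_pow]
    exact hs.iterate n
  let K : ℕ →o Ideal Rp := ⟨fun n => RingHom.ker (f ^ n), monotone_nat_of_le_succ (by
    intro n x hx
    rw [RingHom.mem_ker] at hx ⊢
    rw [hsucc, hx, map_zero])⟩
  obtain ⟨n, h⟩ := monotone_stabilizes_iff_noetherian.2
    (inferInstance : IsNoetherian Rp Rp) K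
  rw [injective_iff_map_eq_zero]
  intro x hx
  obtain ⟨y, rfl⟩ := hn n x
  have hy : y ∈ K (n + 1) := by
    change (f ^ (n + 1)) y = 0
    rw [hsucc, hx]
  rw [← h (n + 1) (Nat.le_succ n)] at hy
  exact hy

lemma aeval_l_injective (l : Fin 5 → Rp) (hl : ∀ i, (l i).IsHomogeneous 1)
    (hind : LinearIndependent ℂ l) : Function.Injective (aeval l : Rp →ₐ[ℂ] Rp) := by
  have hs : Function.Surjective (aeval l : Rp →ₐ[ℂ] Rp) := by
    rw [← AlgHom.range_eq_top, eq_top_iff, ← MvPolynomial.adjoin_range_X, Algebra.adjoin_le_iff]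
    rintro _ ⟨i, rfl⟩
    have hX : (X i : Rp) ∈ Submodule.span ℂ (Set.range l) := by
      rw [span_l l hl hind]; exact isHomogeneous_X _ _
    have hle : Submodule.span ℂ (Set.range l) ≤
        Subalgebra.toSubmodule (aeval l : Rp →ₐ[ℂ] Rp).range := by
      rw [Submodule.span_le]
      rintro _ ⟨j, rfl⟩
      exact ⟨X j, by simp⟩
    exact hle hX
  exact inj_of_surj_endo (aeval l : Rp →ₐ[ℂ] Rp).toRingHom hs

/-- The cubic with given exponent. -/
def cubMon (l : Fin 5 → Rp) (m : Multiset (Fin 5)) : Rp := (m.map l).prod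

lemma cubMon_eq (l : Fin 5 → Rp) (m : Multiset (Fin 5)) :
    cubMon l m = aeval l (monomial (Multiset.toFinsupp m) (1 : ℂ)) := by
  rw [aeval_monomial, map_one, one_mul, cubMon]
  induction m using Multiset.induction_on with
  | empty => simp
  | cons a s ih =>
    rw [Multiset.map_cons, Multiset.prod_cons, ih, ← Multiset.singleton_add, map_add,
      Finsupp.prod_add_index']
    · simp
    · simp
    · intro i a b; exact pow_add _ _ _

lemma cubMon_indep (l : Fin 5 → Rp) (hl : ∀ i, (l i).IsHomogeneous 1)
    (hind : LinearIndependent ℂ l) : LinearIndependent ℂ (cubMon l) := by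
  have h := (basisMonomials (Fin 5) ℂ).linearIndependent.comp
    (fun m : Multiset (Fin 5) => Multiset.toFinsupp m) Multiset.toFinsupp.injective
  have h2 := h.map' (aeval l : Rp →ₐ[ℂ] Rp).toLinearMap
    (LinearMap.ker_eq_bot.2 (aeval_l_injective l hl hind))
  have h3 : cubMon l = (aeval l : Rp →ₐ[ℂ] Rp).toLinearMap ∘
      (basisMonomials (Fin 5) ℂ) ∘ fun m : Multiset (Fin 5) => Multiset.toFinsupp m := by
    funext m
    simp [cubMon_eq]
  rw [h3]
  exact h2

/-- The skew matrix with `p` at position `(i,j)`. -/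
def skewE (i j : Fin 6) (p : Rp) : Matrix (Fin 6) (Fin 6) Rp :=
  Matrix.of fun a b =>
    (if a = i ∧ b = j then p else 0) - (if a = j ∧ b = i then p else 0)

lemma skewE_mem (i j : Fin 6) (p : Rp) (hp : p.IsHomogeneous 1) : skewE i j p ∈ SkewLin := by
  have h0 : ∀ (c : Prop) [Decidable c],
      (if c then p else 0) ∈ homogeneousSubmodule (Fin 5) ℂ 1 := by
    intro c _
    split_ifs
    · exact hp
    · exact zero_mem _
  refine ⟨?_, fun a b => ?_⟩
  · ext1 a b
    simp [skewE, and_comm]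
  · exact sub_mem (h0 _) (h0 _)

lemma dPf_single_mem (l : Fin 5 → Rp) (q : Fin 8) (p : Rp) (hp : p.IsHomogeneous 1) :
    ∃ N ∈ SkewLin, dPf l N = l (quadIdx q).1 * l (quadIdx q).2 * p ∨
      dPf l N = -(l (quadIdx q).1 * l (quadIdx q).2 * p) := by
  have hz : ∀ i j, skewE i j p ∈ SkewLin := fun i j => skewE_mem i j p hp
  refine ⟨skewE (![0, 0, 0, 0, 1, 1, 1, 2] q) (![2, 3, 4, 5, 2, 4, 5, 5] q) p, hz _ _, ?_⟩
  fin_cases q <;> simp [dPf, skewE, quadIdx]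

lemma cubMon_cubExp (l : Fin 5 → Rp) (q : Fin 8) (k : Fin 5) :
    cubMon l (cubExp (q, k)) = l (quadIdx q).1 * l (quadIdx q).2 * l k := by
  simp [cubMon, cubExp, mul_assoc]

lemma range_eq (l : Fin 5 → Rp) (hl : ∀ i, (l i).IsHomogeneous 1)
    (hind : LinearIndependent ℂ l) :
    (LinearMap.range (PhiE l hl)).map Cubics.subtype =
      Submodule.span ℂ (Set.range fun m : cubSet => cubMon l m) := by
  apply le_antisymm
  · rintro _ ⟨_, ⟨N, rfl⟩, rfl⟩
    change dPf l N.1 ∈ _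
    have h : ∀ i j, N.1 i j ∈ homogeneousSubmodule (Fin 5) ℂ 1 := fun i j => N.2.2 i j
    have key : ∀ (q : Fin 8) (p : Rp), p ∈ homogeneousSubmodule (Fin 5) ℂ 1 →
        l (quadIdx q).1 * l (quadIdx q).2 * p ∈
          Submodule.span ℂ (Set.range fun m : cubSet => cubMon l m) := by
      intro q p hp
      rw [← span_l l hl hind] at hp
      induction hp using Submodule.span_induction with
      | mem x hx =>
        obtain ⟨k, rfl⟩ := hx
        apply Submodule.subset_span
        exact ⟨⟨cubExp (q, k), Finset.mem_image_of_mem _ (Finset.mem_univ _)⟩,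
          cubMon_cubExp l q k⟩
      | zero => simp
      | add x y _ _ hx hy => rw [mul_add]; exact add_mem hx hy
      | smul c x _ hx => rw [mul_smul_comm]; exact Submodule.smul_mem _ c hx
    have h2 : ∀ i j a b, N.1 i j + N.1 a b ∈ homogeneousSubmodule (Fin 5) ℂ 1 :=
      fun i j a b => add_mem (h i j) (h a b)
    unfold dPf
    exact sub_mem (add_mem (sub_mem (add_mem (sub_mem (add_mem (sub_mem (neg_mem
      (key 0 _ (h _ _))) (key 1 _ (h _ _))) (key 2 _ (h2 _ _ _ _)))
      (key 3 _ (h2 _ _ _ _))) (key 4 _ (h _ _))) (key 5 _ (h _ _)))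
      (key 6 _ (h2 _ _ _ _))) (key 7 _ (h _ _))
  · rw [Submodule.span_le]
    rintro _ ⟨⟨m, hm⟩, rfl⟩
    obtain ⟨⟨q, k⟩, -, rfl⟩ := Finset.mem_image.1 hm
    change cubMon l (cubExp (q, k)) ∈ _
    rw [cubMon_cubExp]
    obtain ⟨N, hN, h⟩ := dPf_single_mem l q (l k) (hl k)
    have hmem : dPf l N ∈ (LinearMap.range (PhiE l hl)).map Cubics.subtype :=
      ⟨PhiE l hl ⟨N, hN⟩, ⟨_, rfl⟩, rfl⟩
    rcases h with h | h
    · rwa [← h]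
    · rw [SetLike.mem_coe, ← neg_mem_iff, ← h]; exact hmem

lemma finrank_PhiE (l : Fin 5 → Rp) (hl : ∀ i, (l i).IsHomogeneous 1)
    (hind : LinearIndependent ℂ l) :
    Module.finrank ℂ (LinearMap.range (PhiE l hl)) = 26 := by
  have h1 := (Submodule.equivMapOfInjective Cubics.subtype Cubics.injective_subtype
    (LinearMap.range (PhiE l hl))).finrank_eq
  have hli : LinearIndependent ℂ (fun m : cubSet => cubMon l m) :=
    (cubMon_indep l hl hind).comp (fun m : cubSet => (m : Multiset (Fin 5)))
      Subtype.val_injective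
  rw [h1, range_eq l hl hind, finrank_span_eq_card hli, Fintype.card_coe, cubSet_card]

/-- Proposition 2.4 (Table 2), case (e). -/
theorem tangent_space_type_e
    (l : Fin 5 → Rp) (hl : ∀ i, (l i).IsHomogeneous 1) (hind : LinearIndependent ℂ l)
    (M : Matrix (Fin 6) (Fin 6) Rp)
    (hM : M = !![0, 0, 0, 0, l 0, l 1;
                 0, 0, 0, -l 0, 0, l 2;
                 0, 0, 0, -l 1, -l 2, 0;
                 0, l 0, l 1, 0, l 3, 0;
                 -l 0, 0, l 2, -l 3, 0, 0;
                 -l 1, -l 2, 0, 0, 0, 0]) :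
    pf M = 0 ∧
    (∀ M' ∈ SkewLin, ∃! F : Rp, F.IsHomogeneous 3 ∧
      pf (jet1 M M') = DualNumber.eps * TrivSqZeroExt.inl F) ∧
    ∃ Φ : SkewLin →ₗ[ℂ] Cubics,
      (∀ M' : SkewLin,
        pf (jet1 M M'.1) = DualNumber.eps * TrivSqZeroExt.inl (Φ M' : Rp)) ∧
      Module.finrank ℂ (LinearMap.range Φ) = 26 := by
  have hM' : M = matE l := hM
  subst hM'
  refine ⟨pf_matE l, fun M' hM' => ⟨dPf l M', ⟨dPf_homog l hl M' hM', pf_jet_matE l M'⟩, ?_⟩,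
    PhiE l hl, fun M' => pf_jet_matE l M'.1, finrank_PhiE l hl hind⟩
  rintro F ⟨-, hF⟩
  exact eps_inl_inj (hF.symm.trans (pf_jet_matE l M'))
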